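/- arXiv:1604.01593 — 8 statements merged into one kernel-verified Lean document; each statement's English description precedes it below -/
import Mathlib

section
/- Let b ∈ ℂ with b ∉ {1, −1}. For every λ ∈ ℂ \ {0} and every finitely supported sequence (h^{(i)})_{i≥0} of complex numbers, the linear operators L_m, W_m (m ∈ ℤ) on ℂ[s,t] satisfy L_m∘L_n − L_n∘L_m = (n−m)L_{m+n}, L_m∘W_n − W_n∘L_m = (n+bm)W_{m+n}, and W_m∘W_n − W_n∘W_m = 0 for all m, n ∈ ℤ; hence ℂ[s,t] is a module over the Lie algebra W(0,b). -/
open MvPolynomial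

noncomputable section

/-- The polynomial ring `ℂ[s,t]`, realized as `MvPolynomial (Fin 2) ℂ`
with `s = X 0` and `t = X 1`. -/
abbrev R2 : Type := MvPolynomial (Fin 2) ℂ

/-- The substitution `f(s,t) ↦ f(s-m,t)`, as a `ℂ`-linear map on `ℂ[s,t]`. -/
def shiftS (m : ℤ) : R2 →ₗ[ℂ] R2 :=
  (aeval (fun i : Fin 2 => if i = 0 then (X 0 - C (m : ℂ) : R2) else (X 1 : R2))).toLinearMap

/-- Multiplication by a fixed polynomial, as a `ℂ`-linear map. -/
def mulBy (p : R2) : R2 →ₗ[ℂ] R2 := LinearMap.mulLeft ℂ p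

/-- The partial derivative `∂/∂t`, as a `ℂ`-linear map. -/
def dT : R2 →ₗ[ℂ] R2 := (pderiv (1 : Fin 2)).toLinearMap

/-- Kronecker delta on `ℂ`. -/
def dlt (x y : ℂ) : ℂ := if x = y then 1 else 0

/-- `q_{n,k;α}(t) = n t^k − δ_{b,−1} n(n−1)α Σ_{j=0}^{k−1} α^{k−1−j} t^j
− δ_{b,1} n α Σ_{j=0}^{k−1} α^{k−1−j} t^j`. -/
def qpoly (b α : ℂ) (n : ℤ) (k : ℕ) : R2 :=
  (n : ℂ) • ((X 1 : R2) ^ k)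
    - (dlt b (-1) * (n : ℂ) * ((n : ℂ) - 1) * α) •
        ∑ j ∈ Finset.range k, (C (α ^ (k - 1 - j)) * (X 1 : R2) ^ j)
    - (dlt b 1 * (n : ℂ) * α) •
        ∑ j ∈ Finset.range k, (C (α ^ (k - 1 - j)) * (X 1 : R2) ^ j)

/-- `h_n(t) = Σ_i h^{(i)} q_{n,i;α}(t)` for a finitely supported sequence `h`. -/
def hpol (b α : ℂ) (h : ℕ →₀ ℂ) (n : ℤ) : R2 := h.sum fun i c => c • qpoly b α n i

/-- The polynomial `t − δ_{b,−1} mα − δ_{b,1}(1−δ_{m,0})α`. -/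
def wcoef (b α : ℂ) (m : ℤ) : R2 :=
  X 1 - C (dlt b (-1) * (m : ℂ) * α + dlt b 1 * (if m = 0 then 0 else 1) * α)

/-- The operator `W_m` of the module `Φ(λ,α,h)`:
`W_m · f(s,t) = λ^m (t − δ_{b,−1} mα − δ_{b,1}(1−δ_{m,0})α) f(s−m,t)`. -/
def PhiW (b lam α : ℂ) (m : ℤ) : R2 →ₗ[ℂ] R2 :=
  mulBy (C (lam ^ m) * wcoef b α m) ∘ₗ shiftS m

/-- The operator `L_m` of the module `Φ(λ,α,h)`:
`L_m · f(s,t) = λ^m (s + h_m(t)) f(s−m,t)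
 + b m λ^m (t − δ_{b,−1} mα − δ_{b,1}(1−δ_{m,0})α) (∂f/∂t)(s−m,t)`. -/
def PhiL (b lam α : ℂ) (h : ℕ →₀ ℂ) (m : ℤ) : R2 →ₗ[ℂ] R2 :=
  mulBy (C (lam ^ m) * (X 0 + hpol b α h m)) ∘ₗ shiftS m
    + (b * (m : ℂ) * lam ^ m) • (mulBy (wcoef b α m) ∘ₗ (shiftS m ∘ₗ dT))

/-- `r_m(t) = Σ_i r^{(i)} m t^i` for a finitely supported sequence `r`. -/
def rpol (r : ℕ →₀ ℂ) (m : ℤ) : R2 := r.sum fun i c => (c * (m : ℂ)) • ((X 1 : R2) ^ i)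

/-- The operator `L_m` of the module `Θ(λ,r)`:
`L_m · f(s,t) = λ^m (s + r_m(t)) f(s−m,t)`. -/
def ThetaL (lam : ℂ) (r : ℕ →₀ ℂ) (m : ℤ) : R2 →ₗ[ℂ] R2 :=
  mulBy (C (lam ^ m) * (X 0 + rpol r m)) ∘ₗ shiftS m

/-- The operator `W_m` of the module `Θ(λ,r)`: `W_m · f(s,t) = δ_{m,0} t f(s,t)`. -/
def ThetaW (m : ℤ) : R2 →ₗ[ℂ] R2 := if m = 0 then mulBy (X 1) else 0

lemma shiftS_mul (m : ℤ) (p q : R2) : shiftS m (p * q) = shiftS m p * shiftS m q := by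
  simp [shiftS]

lemma shiftS_C (m : ℤ) (c : ℂ) : shiftS m (C c) = C c := by
  simp [shiftS, algebraMap_eq]

lemma shiftS_X_zero (m : ℤ) : shiftS m (X 0) = X 0 - C (m : ℂ) := by
  simp [shiftS]

lemma shiftS_X_one (m : ℤ) : shiftS m (X 1) = X 1 := by
  simp [shiftS]

lemma shiftS_X_one_pow (m : ℤ) (k : ℕ) : shiftS m (X 1 ^ k) = X 1 ^ k := by
  simp [shiftS]

lemma shiftS_shiftS (m n : ℤ) (f : R2) : shiftS m (shiftS n f) = shiftS (m + n) f := by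
  induction f using MvPolynomial.induction_on with
  | C c => simp only [shiftS_C]
  | add p q hp hq => simp only [map_add, hp, hq]
  | mul_X p i hp =>
    rw [shiftS_mul, shiftS_mul, shiftS_mul, hp]
    fin_cases i
    · simp only [Fin.zero_eta, shiftS_X_zero, map_sub, shiftS_C, Int.cast_add, map_add]
      ring
    · simp only [Fin.mk_one, shiftS_X_one]

lemma dT_mul (p q : R2) : dT (p * q) = p * dT q + q * dT p := by
  simp [dT]

lemma dT_C (c : ℂ) : dT (C c) = 0 := by
  simp [dT]

lemma dT_X_zero : dT (X 0) = 0 := by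
  simp [dT, pderiv_X]

lemma dT_X_one : dT (X 1) = 1 := by
  simp [dT, pderiv_X]

lemma dT_shiftS (m : ℤ) (f : R2) : dT (shiftS m f) = shiftS m (dT f) := by
  induction f using MvPolynomial.induction_on with
  | C c => simp only [shiftS_C, dT_C, map_zero]
  | add p q hp hq => simp only [map_add, hp, hq]
  | mul_X p i hp =>
    rw [shiftS_mul, dT_mul, dT_mul, map_add, shiftS_mul, shiftS_mul, hp]
    fin_cases i
    · simp only [Fin.zero_eta, shiftS_X_zero, map_sub, dT_X_zero, dT_C, map_zero, sub_zero]
    · have h1 : shiftS m 1 = 1 := by simp [shiftS]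
      simp only [Fin.mk_one, shiftS_X_one, dT_X_one, h1]

/-- At `α = 0` the polynomial `h_m(t)` is `m` times `Σ_i h^{(i)} t^i`. -/
lemma hpol_zero (b : ℂ) (h : ℕ →₀ ℂ) (m : ℤ) :
    hpol b 0 h m = C (m : ℂ) * h.sum fun i c => c • (X 1 : R2) ^ i := by
  simp only [hpol, qpoly, mul_zero, zero_smul, sub_zero, Finsupp.sum, Finset.mul_sum]
  refine Finset.sum_congr rfl fun i _ => ?_
  simp only [smul_eq_C_mul]
  ring

lemma shiftS_sum_X_one_pow (m : ℤ) (h : ℕ →₀ ℂ) :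
    shiftS m (h.sum fun i c => c • (X 1 : R2) ^ i) = h.sum fun i c => c • (X 1 : R2) ^ i := by
  simp only [Finsupp.sum, map_sum, map_smul, shiftS_X_one_pow]

lemma PhiW_zero_apply (b lam : ℂ) (m : ℤ) (f : R2) :
    PhiW b lam 0 m f = C (lam ^ m) * X 1 * shiftS m f := by
  simp [PhiW, wcoef, mulBy, mul_assoc]

lemma PhiL_zero_apply (b lam : ℂ) (h : ℕ →₀ ℂ) (m : ℤ) (f : R2) :
    PhiL b lam 0 h m f =
      C (lam ^ m) * (X 0 + C (m : ℂ) * h.sum fun i c => c • (X 1 : R2) ^ i) * shiftS m f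
        + C b * C (m : ℂ) * C (lam ^ m) * X 1 * shiftS m (dT f) := by
  simp [PhiL, wcoef, mulBy, hpol_zero, smul_eq_C_mul, mul_assoc]

/-- for `b ∉ {1,−1}`, the operators `L_m, W_m` on `ℂ[s,t]` satisfy the
defining relations of the Lie algebra `W(0,b)`, so `ℂ[s,t]` is a `W(0,b)`-module. -/
theorem stmt0 (b : ℂ) (hb1 : b ≠ 1) (hb2 : b ≠ -1) (lam : ℂ) (hlam : lam ≠ 0) (h : ℕ →₀ ℂ) :
    (∀ m n : ℤ,
      PhiL b lam 0 h m ∘ₗ PhiL b lam 0 h n - PhiL b lam 0 h n ∘ₗ PhiL b lam 0 h m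
        = ((n : ℂ) - (m : ℂ)) • PhiL b lam 0 h (m + n)) ∧
    (∀ m n : ℤ,
      PhiL b lam 0 h m ∘ₗ PhiW b lam 0 n - PhiW b lam 0 n ∘ₗ PhiL b lam 0 h m
        = ((n : ℂ) + b * (m : ℂ)) • PhiW b lam 0 (m + n)) ∧
    (∀ m n : ℤ,
      PhiW b lam 0 m ∘ₗ PhiW b lam 0 n - PhiW b lam 0 n ∘ₗ PhiW b lam 0 m = 0) := by
  have hg : ∀ k, shiftS k (h.sum fun i c => c • (X 1 : R2) ^ i) = _ :=
    fun k => shiftS_sum_X_one_pow k h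
  have hL := PhiL_zero_apply b lam h
  have hW := PhiW_zero_apply b lam
  generalize (h.sum fun i c => c • (X 1 : R2) ^ i) = g at hg hL
  have hdg : ∀ k, shiftS k (dT g) = dT g := fun k => by rw [← dT_shiftS, hg]
  refine ⟨fun m n => ?_, fun m n => ?_, fun m n => ?_⟩ <;>
  · refine LinearMap.ext fun f => ?_
    have h1 : ∀ k, shiftS k (1 : R2) = 1 := fun k => by simp [shiftS]
    simp only [LinearMap.sub_apply, LinearMap.comp_apply, LinearMap.smul_apply,
      LinearMap.zero_apply, hL, hW, map_add, map_sub, shiftS_mul, dT_mul, shiftS_C,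
      shiftS_X_zero, shiftS_X_one, hg, hdg, dT_C, dT_X_zero, dT_X_one, dT_shiftS, shiftS_shiftS,
      map_zero, h1, smul_eq_C_mul, zpow_add₀ hlam, Int.cast_add, map_mul, add_comm n m]
    ring
end
end

section
/- Let λ, μ ∈ ℂ \ {0} and let (r^{(i)})_{i≥0}, (w^{(i)})_{i≥0} be finitely supported sequences of complex numbers, with associated polynomials r_n(t) = Σ_i r^{(i)} n t^i and w_n(t) = Σ_i w^{(i)} n t^i. Then the W(0,1)-modules Θ(λ,r) and Θ(μ,w) are isomorphic if and only if λ = μ and r_n = w_n for all n ∈ ℤ. -/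
open MvPolynomial

noncomputable section

theorem rpol_zero (r : ℕ →₀ ℂ) : rpol r 0 = 0 := by
  simp [rpol]

theorem pderiv_zero_rpol (r : ℕ →₀ ℂ) (m : ℤ) : pderiv 0 (rpol r m) = 0 := by
  simp [rpol, Finsupp.sum]

theorem ThetaL_apply_C (lam : ℂ) (r : ℕ →₀ ℂ) (m : ℤ) (c : ℂ) :
    ThetaL lam r m (C c) = C (lam ^ m) * (X 0 + rpol r m) * C c := by
  simp [ThetaL, mulBy, shiftS, algebraMap_eq, mul_assoc]

theorem ThetaL_zero_apply (lam : ℂ) (r : ℕ →₀ ℂ) (f : R2) : ThetaL lam r 0 f = X 0 * f := by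
  have hX : (fun i : Fin 2 => if i = 0 then (X 0 : R2) else X 1) = X := by
    funext i; fin_cases i <;> simp
  simp [ThetaL, mulBy, shiftS, rpol_zero, hX]

theorem ThetaW_zero_apply (f : R2) : ThetaW 0 f = X 1 * f := by
  simp [ThetaW, mulBy]

/-- A linear endomorphism of a polynomial ring commuting with multiplication by the variables
commutes with multiplication by every polynomial. -/
theorem map_mul_of_map_X_mul {R σ : Type*} [CommSemiring R]
    (φ : MvPolynomial σ R →ₗ[R] MvPolynomial σ R)
    (h : ∀ i f, φ (X i * f) = X i * φ f) (p f : MvPolynomial σ R) : φ (p * f) = p * φ f := by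
  induction p using MvPolynomial.induction_on generalizing f with
  | C a => simp [C_mul']
  | add p q hp hq => simp [add_mul, hp, hq]
  | mul_X p i hp => rw [mul_assoc, hp, h, mul_assoc]

/-- the `W(0,1)`-modules `Θ(λ,r)` and `Θ(μ,w)` are isomorphic
if and only if `λ = μ` and `r_n = w_n` for all `n ∈ ℤ`. -/
theorem stmt6 (lam mu : ℂ) (hlam : lam ≠ 0) (hmu : mu ≠ 0) (r w : ℕ →₀ ℂ) :
    (∃ φ : R2 ≃ₗ[ℂ] R2,
      (∀ m : ℤ, φ.toLinearMap ∘ₗ ThetaL lam r m = ThetaL mu w m ∘ₗ φ.toLinearMap) ∧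
      (∀ m : ℤ, φ.toLinearMap ∘ₗ ThetaW m = ThetaW m ∘ₗ φ.toLinearMap))
      ↔ (lam = mu ∧ ∀ n : ℤ, rpol r n = rpol w n) := by
  constructor
  · rintro ⟨φ, hL, hW⟩
    have hX : ∀ (i : Fin 2) (f : R2), φ (X i * f) = X i * φ f := by
      intro i f
      fin_cases i
      · simpa [ThetaL_zero_apply] using LinearMap.congr_fun (hL 0) f
      · simpa [ThetaW_zero_apply] using LinearMap.congr_fun (hW 0) f
    have hmul (p : R2) : φ p = p * φ 1 := by
      simpa using map_mul_of_map_X_mul φ.toLinearMap hX p 1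
    obtain ⟨p, hp⟩ := φ.surjective 1
    have hunit : IsUnit (φ 1) := IsUnit.of_mul_eq_one_right p (by rw [← hmul, hp])
    obtain ⟨c, hc, hφ⟩ := MvPolynomial.isUnit_iff_eq_C_of_isReduced.mp hunit
    have key (m : ℤ) :
        (C (lam ^ m) * (X 0 + rpol r m) : R2) = C (mu ^ m) * (X 0 + rpol w m) := by
      have h := LinearMap.congr_fun (hL m) (C 1)
      simp only [LinearMap.comp_apply, LinearEquiv.coe_coe, ThetaL_apply_C] at h
      rw [C_1, mul_one, hmul, hφ, ThetaL_apply_C] at h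
      exact mul_right_cancel₀ (by simpa using hc.ne_zero) h
    have hlm : lam = mu := by
      simpa [pderiv_zero_rpol] using congrArg (pderiv 0) (key 1)
    refine ⟨hlm, fun n => ?_⟩
    subst hlm
    exact add_left_cancel
      (mul_left_cancel₀ (by simpa using zpow_ne_zero n hlam) (key n))
  · rintro ⟨rfl, h⟩
    exact ⟨LinearEquiv.refl ℂ R2, fun m => by simp [ThetaL, h m], fun m => by simp⟩
end
end

section
/- For every λ ∈ ℂ \ {0} and every finitely supported sequence (r^{(i)})_{i≥0} of complex numbers, the W(0,1)-module Θ(λ,r) is reducible, i.e. it has a submodule different from 0 and from the whole module. -/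
open MvPolynomial

noncomputable section

theorem shiftS_mul_X_one (m : ℤ) (g : R2) : shiftS m (X 1 * g) = X 1 * shiftS m g := by
  simp [shiftS]

theorem thetaL_mul_X_one (lam : ℂ) (r : ℕ →₀ ℂ) (m : ℤ) (g : R2) :
    ThetaL lam r m (X 1 * g) = X 1 * ThetaL lam r m g := by
  simp only [ThetaL, mulBy, LinearMap.comp_apply, LinearMap.mulLeft_apply, shiftS_mul_X_one]
  ring

/-- the `W(0,1)`-module `Θ(λ,r)` is reducible: it has a submodule
(a subspace invariant under all `L_m, W_m`) different from `0` and the whole module. -/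
theorem stmt8 (lam : ℂ) (hlam : lam ≠ 0) (r : ℕ →₀ ℂ) :
    ∃ p : Submodule ℂ R2,
      (∀ m : ℤ, ∀ f ∈ p, ThetaL lam r m f ∈ p ∧ ThetaW m f ∈ p) ∧ p ≠ ⊥ ∧ p ≠ ⊤ := by
  refine ⟨(Ideal.span {(X 1 : R2)}).restrictScalars ℂ, fun m f hf => ?_, fun h => ?_, fun h => ?_⟩
  · simp only [Submodule.restrictScalars_mem, Ideal.mem_span_singleton] at hf ⊢
    obtain ⟨g, rfl⟩ := hf
    refine ⟨⟨_, thetaL_mul_X_one lam r m g⟩, ?_⟩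
    unfold ThetaW
    split_ifs
    · exact ⟨X 1 * g, rfl⟩
    · exact dvd_zero _
  · rw [Submodule.restrictScalars_eq_bot_iff, Ideal.span_singleton_eq_bot] at h
    exact X_ne_zero _ h
  · rw [Submodule.restrictScalars_eq_top_iff, Ideal.span_singleton_eq_top] at h
    simpa using h.map (constantCoeff : R2 →+* ℂ)
end
end

section
/- Let b ∈ ℂ with b ∉ {1, −1}. Then for all λ ∈ ℂ \ {0} and α ∈ ℂ, the W(0,b)-module Φ(λ,α,h) is isomorphic to Φ(λ,0,h); moreover, for λ, μ ∈ ℂ \ {0} and finitely supported sequences (h^{(i)}), (e^{(i)}) with associated polynomials h_n(t) = Σ_i h^{(i)} n t^i and e_n(t) = Σ_i e^{(i)} n t^i, the modules Φ(λ,0,h) and Φ(μ,0,e) are isomorphic if and only if λ = μ and h_n = e_n for all n ∈ ℤ. -/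
open MvPolynomial

noncomputable section

lemma hpol_zero_s9 (b α : ℂ) (h : ℕ →₀ ℂ) : hpol b α h 0 = 0 := by
  simp [hpol, qpoly]

/-- Away from `b = 1` and `b = -1` the polynomials `q_{n,k;α}` do not depend on `α`. -/
lemma qpoly_eq {b : ℂ} (hb1 : b ≠ 1) (hb2 : b ≠ -1) (α : ℂ) (n : ℤ) (k : ℕ) :
    qpoly b α n k = qpoly b 0 n k := by
  simp [qpoly, dlt, hb1, hb2]

lemma wcoef_eq_X {b : ℂ} (hb1 : b ≠ 1) (hb2 : b ≠ -1) (α : ℂ) (m : ℤ) :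
    wcoef b α m = X 1 := by
  simp [wcoef, dlt, hb1, hb2]

lemma shiftS_one (m : ℤ) : shiftS m 1 = 1 := by
  simpa using shiftS_C m 1

lemma shiftS_zero_apply (f : R2) : shiftS 0 f = f := by
  have key : (fun i : Fin 2 => if i = 0 then (X 0 - C ((0 : ℤ) : ℂ) : R2) else X 1) = X := by
    funext i
    fin_cases i <;> simp
  simp only [shiftS, key, AlgHom.toLinearMap_apply, aeval_X_left, AlgHom.id_apply]

lemma PhiL_zero_apply_s9 (b lam α : ℂ) (h : ℕ →₀ ℂ) (f : R2) :
    PhiL b lam α h 0 f = X 0 * f := by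
  simp [PhiL, mulBy, shiftS_zero_apply, hpol_zero_s9]

lemma PhiL_C (b lam α c : ℂ) (h : ℕ →₀ ℂ) (m : ℤ) :
    PhiL b lam α h m (C c) = C (lam ^ m) * (X 0 + hpol b α h m) * C c := by
  simp [PhiL, mulBy, shiftS_C, dT_C, mul_assoc]

lemma PhiW_apply {b : ℂ} (hb1 : b ≠ 1) (hb2 : b ≠ -1) (lam α : ℂ) (m : ℤ) (f : R2) :
    PhiW b lam α m f = C (lam ^ m) * X 1 * shiftS m f := by
  simp [PhiW, mulBy, wcoef_eq_X hb1 hb2, mul_assoc]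

/-- A linear map on `ℂ[s,t]` commuting with both variables is multiplication by its value
at `1`. -/
lemma apply_eq_mul_apply_one (φ : R2 →ₗ[ℂ] R2) (h : ∀ i f, φ (X i * f) = X i * φ f) (f : R2) :
    φ f = f * φ 1 := by
  induction f using MvPolynomial.induction_on with
  | C c =>
    have hc : (C c : R2) = c • 1 := by simp [smul_eq_C_mul]
    rw [hc, map_smul, smul_mul_assoc, one_mul]
  | add p q hp hq => rw [map_add, hp, hq, add_mul]
  | mul_X p i hp => rw [mul_comm p, h, hp, mul_assoc]

/-- A linear automorphism of `ℂ[s,t]` commuting with both variables is a nonzero scalar. -/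
lemma exists_apply_eq_mul_C (φ : R2 ≃ₗ[ℂ] R2) (h : ∀ i f, φ (X i * f) = X i * φ f) :
    ∃ c : ℂ, c ≠ 0 ∧ ∀ f, φ f = f * C c := by
  have key := apply_eq_mul_apply_one φ.toLinearMap h
  simp only [LinearEquiv.coe_coe] at key
  obtain ⟨g, hg⟩ := φ.surjective 1
  have hu : IsUnit (φ 1) := IsUnit.of_mul_eq_one_right g (by rw [← key, hg])
  obtain ⟨c, hc, hc'⟩ := MvPolynomial.isUnit_iff_eq_C_of_isReduced.mp hu
  exact ⟨c, hc.ne_zero, fun f => by rw [key, hc']⟩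

/-- for `b ∉ {1,−1}`: `Φ(λ,α,h) ≅ Φ(λ,0,h)` for all `λ ≠ 0, α`; and
`Φ(λ,0,h) ≅ Φ(μ,0,e)` if and only if `λ = μ` and `h_n = e_n` for all `n ∈ ℤ`. -/
theorem stmt9 (b : ℂ) (hb1 : b ≠ 1) (hb2 : b ≠ -1) :
    (∀ lam : ℂ, lam ≠ 0 → ∀ (α : ℂ) (h : ℕ →₀ ℂ),
      ∃ φ : R2 ≃ₗ[ℂ] R2,
        (∀ m : ℤ, φ.toLinearMap ∘ₗ PhiL b lam α h m = PhiL b lam 0 h m ∘ₗ φ.toLinearMap) ∧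
        (∀ m : ℤ, φ.toLinearMap ∘ₗ PhiW b lam α m = PhiW b lam 0 m ∘ₗ φ.toLinearMap)) ∧
    (∀ lam mu : ℂ, lam ≠ 0 → mu ≠ 0 → ∀ h e : ℕ →₀ ℂ,
      ((∃ φ : R2 ≃ₗ[ℂ] R2,
        (∀ m : ℤ, φ.toLinearMap ∘ₗ PhiL b lam 0 h m = PhiL b mu 0 e m ∘ₗ φ.toLinearMap) ∧
        (∀ m : ℤ, φ.toLinearMap ∘ₗ PhiW b lam 0 m = PhiW b mu 0 m ∘ₗ φ.toLinearMap))
        ↔ (lam = mu ∧ ∀ n : ℤ, hpol b 0 h n = hpol b 0 e n))) := by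
  refine ⟨fun lam _ α h => ⟨LinearEquiv.refl ℂ R2, fun m => ?_, fun m => ?_⟩,
    fun lam mu hlam _ h e => ⟨?_, ?_⟩⟩
  · have hh : hpol b α h m = hpol b 0 h m := by simp only [hpol, qpoly_eq hb1 hb2 α]
    refine LinearMap.ext fun f => ?_
    simp [PhiL, hh, wcoef_eq_X hb1 hb2]
  · refine LinearMap.ext fun f => ?_
    simp [PhiW_apply hb1 hb2]
  · rintro ⟨φ, hL, hW⟩
    have hL' (m : ℤ) (f : R2) : φ (PhiL b lam 0 h m f) = PhiL b mu 0 e m (φ f) :=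
      LinearMap.congr_fun (hL m) f
    have hW' (m : ℤ) (f : R2) : φ (PhiW b lam 0 m f) = PhiW b mu 0 m (φ f) :=
      LinearMap.congr_fun (hW m) f
    obtain ⟨c, hc, hφ⟩ := exists_apply_eq_mul_C φ fun i f => by
      fin_cases i
      · simpa [PhiL_zero_apply_s9] using hL' 0 f
      · simpa [PhiW_apply hb1 hb2, shiftS_zero_apply] using hW' 0 f
    have hCc : (C c : R2) ≠ 0 := by simpa using hc
    have hlm : lam = mu := by
      have h1 := hW' 1 1
      simp only [PhiW_apply hb1 hb2, hφ, one_mul, shiftS_C, shiftS_one, mul_one, zpow_one] at h1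
      exact C_injective _ _ (mul_right_cancel₀ (X_ne_zero 1) (mul_right_cancel₀ hCc h1))
    subst hlm
    refine ⟨rfl, fun n => ?_⟩
    have h1 := hL' n (C 1)
    rw [PhiL_C, hφ, hφ, C_1, one_mul, mul_one, PhiL_C] at h1
    have hl : (C (lam ^ n) : R2) ≠ 0 := by simpa using zpow_ne_zero n hlam
    exact add_left_cancel (mul_left_cancel₀ hl (mul_right_cancel₀ hCc h1))
  · rintro ⟨rfl, hhe⟩
    refine ⟨LinearEquiv.refl ℂ R2, fun m => ?_, fun m => rfl⟩
    simp only [PhiL, hhe]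
    rfl
end
end

section
/- Let b ∈ ℂ with b ∉ {1, −1}. Then for every λ ∈ ℂ \ {0} and every finitely supported sequence (h^{(i)})_{i≥0} of complex numbers, the W(0,b)-module Φ(λ,0,h) is reducible, i.e. it has a submodule different from 0 and from the whole module. -/
open MvPolynomial

noncomputable section

theorem wcoef_zero (b : ℂ) (m : ℤ) : wcoef b 0 m = X 1 := by
  simp [wcoef]

theorem X_one_dvd_shiftS {f : R2} (hf : X 1 ∣ f) (m : ℤ) : X 1 ∣ shiftS m f := by
  obtain ⟨g, rfl⟩ := hf
  exact ⟨shiftS m g, by simp [shiftS]⟩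

/-- for `b ∉ {1,−1}`, the `W(0,b)`-module `Φ(λ,0,h)` is reducible:
it has a submodule (a subspace invariant under all `L_m, W_m`) different from `0`
and the whole module. -/
theorem stmt10 (b : ℂ) (hb1 : b ≠ 1) (hb2 : b ≠ -1) (lam : ℂ) (hlam : lam ≠ 0)
    (h : ℕ →₀ ℂ) :
    ∃ p : Submodule ℂ R2,
      (∀ m : ℤ, ∀ f ∈ p, PhiL b lam 0 h m f ∈ p ∧ PhiW b lam 0 m f ∈ p) ∧ p ≠ ⊥ ∧ p ≠ ⊤ := by
  refine ⟨(Ideal.span {(X 1 : R2)}).restrictScalars ℂ, fun m f hf => ?_, fun hbot => ?_,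
    fun htop => ?_⟩
  · simp only [Submodule.restrictScalars_mem, Ideal.mem_span_singleton] at hf ⊢
    refine ⟨dvd_add (dvd_mul_of_dvd_right (X_one_dvd_shiftS hf m) _) ?_, ?_⟩
    · change X 1 ∣ (b * (m : ℂ) * lam ^ m) • (wcoef b 0 m * shiftS m (dT f))
      rw [wcoef_zero]
      exact dvd_smul_of_dvd _ (dvd_mul_right _ _)
    · exact dvd_mul_of_dvd_right (X_one_dvd_shiftS hf m) _
  · have hX : (X 1 : R2) ∈ (Ideal.span {(X 1 : R2)}).restrictScalars ℂ :=
      Ideal.mem_span_singleton_self _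
    rw [hbot] at hX
    exact X_ne_zero 1 ((Submodule.mem_bot ℂ).1 hX)
  · have hone : (1 : R2) ∈ (Ideal.span {(X 1 : R2)}).restrictScalars ℂ := by
      rw [htop]
      exact Submodule.mem_top
    obtain ⟨g, hg⟩ := Ideal.mem_span_singleton.1 hone
    simpa using congrArg constantCoeff hg
end
end

section
/- Let a ∈ ℂ and for each m ∈ ℤ let a_m ∈ ℂ[x,y] be a nonzero polynomial, with a_0(x,y) = y. Suppose that for all m, n ∈ ℤ the identity a_n(x − (a+m), y)·a_m(x, y) = a_m(x − (a+n), y)·a_n(x, y) holds in ℂ[x,y]. Then every a_m has degree 0 in x, i.e. a_m ∈ ℂ[y] for all m ∈ ℤ. -/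
namespace Polynomial

theorem nextCoeff_mul_of_noZeroDivisors {R : Type*} [CommRing R] [NoZeroDivisors R] (p q : R[X]) :
    (p * q).nextCoeff = p.leadingCoeff * q.nextCoeff + p.nextCoeff * q.leadingCoeff := by
  rw [← coeff_one_reverse, reverse_mul_of_domain, mul_coeff_one, coeff_one_reverse,
    coeff_one_reverse, coeff_zero_reverse, coeff_zero_reverse]

theorem nextCoeff_taylor {R : Type*} [CommRing R] (r : R) (p : R[X]) :
    (taylor r p).nextCoeff = p.nextCoeff + p.natDegree * p.leadingCoeff * r := by
  rcases Nat.eq_zero_or_pos p.natDegree with h | h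
  · rw [nextCoeff, nextCoeff, natDegree_taylor, if_pos h, if_pos h, h]
    simp
  · rw [nextCoeff_of_natDegree_pos h, nextCoeff_of_natDegree_pos (by rwa [natDegree_taylor]),
      natDegree_taylor, taylor_coeff, eval_eq_sum_range' (n := 2)]
    · obtain ⟨d, hd⟩ := Nat.exists_eq_succ_of_ne_zero h.ne'
      simp [Finset.sum_range_succ, hasseDeriv_coeff, leadingCoeff, hd, add_comm 1 d]
    · have := natDegree_hasseDeriv_le p (p.natDegree - 1)
      omega

theorem mul_natDegree_eq_of_taylor_mul_eq {R : Type*} [CommRing R] [IsDomain R] {p q : R[X]}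
    (hp : p ≠ 0) (hq : q ≠ 0) {r s : R} (h : taylor r p * q = taylor s q * p) :
    r * p.natDegree = s * q.natDegree := by
  have hc := congrArg nextCoeff h
  simp only [nextCoeff_mul_of_noZeroDivisors, nextCoeff_taylor, leadingCoeff_taylor] at hc
  refine mul_left_cancel₀ (mul_ne_zero (leadingCoeff_ne_zero.2 hp) (leadingCoeff_ne_zero.2 hq)) ?_
  linear_combination hc

end Polynomial

open MvPolynomial

theorem MvPolynomial.finSuccEquiv_aeval_X_sub_C {R : Type*} [CommRing R] (c : R)
    (p : MvPolynomial (Fin 2) R) :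
    finSuccEquiv R 1 (aeval (![(X 0 : MvPolynomial (Fin 2) R) - C c, X 1]) p)
      = Polynomial.taylor (C (-c)) (finSuccEquiv R 1 p) := by
  have hX : finSuccEquiv R 1 (X 1) = Polynomial.C (X 0) := finSuccEquiv_X_succ (j := 0)
  have hC (b : R) : finSuccEquiv R 1 (C b) = Polynomial.C (C b) :=
    (finSuccEquiv R 1).commutes b
  induction p using MvPolynomial.induction_on with
  | C b => simp [hC, algebraMap_eq]
  | add p q hp hq => simp only [map_add, hp, hq]
  | mul_X p i hp =>
    rw [map_mul, map_mul, map_mul, hp, Polynomial.taylor_mul, aeval_X]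
    refine congrArg _ ?_
    revert i
    rw [Fin.forall_fin_two]
    constructor
    · simp [hC, finSuccEquiv_X_zero, sub_eq_add_neg]
    · simp [hX]

/-- let `a ∈ ℂ` and let `(a_m)_{m ∈ ℤ}` be nonzero polynomials in
`ℂ[x,y]` (here `x = X 0`, `y = X 1`) with `a_0 = y`, satisfying
`a_n(x−(a+m),y) a_m(x,y) = a_m(x−(a+n),y) a_n(x,y)` for all `m, n ∈ ℤ`.
Then every `a_m` has degree `0` in `x`, i.e. `a_m ∈ ℂ[y]`. -/
theorem stmt16 (a : ℂ) (A : ℤ → MvPolynomial (Fin 2) ℂ)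
    (hne : ∀ m : ℤ, A m ≠ 0) (h0 : A 0 = X 1)
    (hrel : ∀ m n : ℤ,
      aeval (![(X 0 : MvPolynomial (Fin 2) ℂ) - C (a + (m : ℂ)), X 1]) (A n) * A m
        = aeval (![(X 0 : MvPolynomial (Fin 2) ℂ) - C (a + (n : ℂ)), X 1]) (A m) * A n) :
    ∀ m : ℤ, (A m).degreeOf 0 = 0 := by
  have key (m n : ℤ) : (a + m) * (A n).degreeOf 0 = (a + n) * (A m).degreeOf 0 := by
    have h := congrArg (finSuccEquiv ℂ 1) (hrel m n)
    rw [map_mul, map_mul, finSuccEquiv_aeval_X_sub_C, finSuccEquiv_aeval_X_sub_C] at h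
    have h' := Polynomial.mul_natDegree_eq_of_taylor_mul_eq
      ((map_ne_zero_iff _ (finSuccEquiv ℂ 1).injective).2 (hne n))
      ((map_ne_zero_iff _ (finSuccEquiv ℂ 1).injective).2 (hne m)) h
    rw [natDegree_finSuccEquiv, natDegree_finSuccEquiv] at h'
    apply C_injective (Fin 1) ℂ
    simp only [map_neg, map_add, map_mul, map_natCast] at h' ⊢
    linear_combination -h'
  have hd0 : (A 0).degreeOf 0 = 0 := by
    rw [h0, degreeOf_X]
    simp
  intro m
  rcases eq_or_ne m 0 with rfl | hm
  · exact hd0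
  have hm' : (m : ℂ) ≠ 0 := Int.cast_ne_zero.2 hm
  have h₁ := key 0 m
  have h₂ := key 0 (-m)
  have h₃ := key m (-m)
  simp only [hd0, Int.cast_zero, add_zero, Nat.cast_zero, mul_zero] at h₁ h₂
  push_cast at h₃
  have hsum : ((A m).degreeOf 0 + (A (-m)).degreeOf 0 : ℂ) = 0 :=
    mul_left_cancel₀ hm' (by linear_combination h₃ + h₁ - h₂)
  have : (A m).degreeOf 0 + (A (-m)).degreeOf 0 = 0 := by exact_mod_cast hsum
  omega
end

section
/- Let b ∈ ℂ, λ ∈ ℂ \ {0}, and let A : ℤ → ℂ satisfy A_0 = 1, A_n ≠ 0 for all n ∈ ℤ, and (n + bm) A_{m+n} = n A_n λ^m + b m A_n A_m for all m, n ∈ ℤ. Then A_m = λ^m for all m ∈ ℤ. -/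
/-- The normalized sequence `B n = A n * lam ^ (-n)` is identically `1`. -/
theorem eq_one_of_normalized_relation (b : ℂ) (B : ℤ → ℂ) (h0 : B 0 = 1)
    (hne : ∀ n : ℤ, B n ≠ 0)
    (hrel : ∀ m n : ℤ, ((n : ℂ) + b * (m : ℂ)) * B (m + n)
        = (n : ℂ) * B n + b * (m : ℂ) * B n * B m) (n : ℤ) : B n = 1 := by
  have hquad : ∀ k : ℤ, k ≠ 0 → B k = 1 ∨ b * B k = 1 - b := by
    intro k hk
    have hk' : (k : ℂ) ≠ 0 := Int.cast_ne_zero.mpr hk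
    have h1 := hrel (-k) k
    have h2 := hrel k (-k)
    rw [neg_add_cancel, h0] at h1
    rw [add_neg_cancel, h0] at h2
    push_cast at h1 h2
    have hsymm : B (-k) = B k := by
      apply mul_left_cancel₀ hk'
      linear_combination h1 + h2
    rw [hsymm] at h1
    have h3 : (B k - 1) * (b * B k - (1 - b)) = 0 := by
      apply mul_left_cancel₀ hk'
      linear_combination h1
    rcases mul_eq_zero.mp h3 with h | h
    · exact Or.inl (sub_eq_zero.mp h)
    · exact Or.inr (sub_eq_zero.mp h)
  by_cases hn : n = 0
  · rw [hn, h0]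
  rcases hquad n hn with h | h
  · exact h
  have hdouble : (1 + b) * B (n + n) = B n * (2 - b) := by
    apply mul_left_cancel₀ (Int.cast_ne_zero.mpr hn : (n : ℂ) ≠ 0)
    linear_combination hrel n n + (n : ℂ) * B n * h
  have hhalf : 2 * b = 1 → B n = 1 := fun hb => by
    linear_combination 2 * h - (B n + 1) * hb
  rcases hquad (n + n) (by omega) with h' | h'
  · rw [h'] at hdouble
    apply hhalf
    linear_combination (b * hdouble + (2 - b) * h) / 2
  · have h3 : (1 - b) * (2 * b - 1) = 0 := by
      linear_combination b * hdouble - (1 + b) * h' + (2 - b) * h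
    rcases mul_eq_zero.mp h3 with hb | hb
    · have hb1 : b = 1 := (sub_eq_zero.mp hb).symm
      subst hb1
      exact absurd (by simpa using h) (hne n)
    · exact hhalf (sub_eq_zero.mp hb)

/-- let `b ∈ ℂ`, `λ ∈ ℂ \ {0}`, and `A : ℤ → ℂ` with `A 0 = 1`,
`A n ≠ 0` for all `n`, and `(n + bm) A_{m+n} = n A_n λ^m + b m A_n A_m` for all
`m, n ∈ ℤ`. Then `A_m = λ^m` for all `m ∈ ℤ`. -/
theorem stmt18 (b lam : ℂ) (hlam : lam ≠ 0) (A : ℤ → ℂ) (h0 : A 0 = 1)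
    (hne : ∀ n : ℤ, A n ≠ 0)
    (hrel : ∀ m n : ℤ, ((n : ℂ) + b * (m : ℂ)) * A (m + n)
        = (n : ℂ) * A n * lam ^ m + b * (m : ℂ) * A n * A m) :
    ∀ m : ℤ, A m = lam ^ m := by
  intro m
  have hpow : ∀ k : ℤ, lam ^ k ≠ 0 := fun k => zpow_ne_zero k hlam
  have h := eq_one_of_normalized_relation b (fun k => A k / lam ^ k) (by simp [h0])
    (fun k => div_ne_zero (hne k) (hpow k)) (fun k l => by
      have hk := hpow k
      have hl := hpow l
      have hkl := hrel k l
      simp only [zpow_add₀ hlam]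
      field_simp
      linear_combination hkl) m
  exact (div_eq_one_iff_eq (hpow m)).mp h
end

section
/- Let b ∈ ℂ, λ ∈ ℂ \ {0}, and let B : ℤ → ℂ satisfy B_0 = 0 and (n + bm) B_{m+n} = n λ^m B_n + b m λ^n B_m for all m, n ∈ ℤ. Then: (i) if b ∉ {1, −1}, then B_m = 0 for all m ∈ ℤ; (ii) if b = 1, then B_m = B_1 λ^{m−1} for all m ∈ ℤ with m ≠ 0; (iii) if b = −1, then B_m = m B_1 λ^{m−1} for all m ∈ ℤ. -/
/-- Reflecting the index in the normalized relation multiplies the sequence by `b`. -/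
theorem eq_mul_neg_of_weighted_additive {b : ℂ} {C : ℤ → ℂ} (h0 : C 0 = 0)
    (h : ∀ m n : ℤ, ((n : ℂ) + b * m) * C (m + n) = n * C n + b * m * C m) (n : ℤ) :
    C n = b * C (-n) := by
  rcases eq_or_ne n 0 with rfl | hn
  · simp [h0]
  have hn' : (n : ℂ) ≠ 0 := Int.cast_ne_zero.mpr hn
  have := h (-n) n
  rw [neg_add_cancel, h0] at this
  push_cast at this
  refine mul_left_cancel₀ hn' ?_
  linear_combination -this

/-- A solution of the normalized relation vanishes unless `b` is `1` or `-1`. -/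
theorem eq_zero_of_weighted_additive {b : ℂ} {C : ℤ → ℂ} (h0 : C 0 = 0)
    (h : ∀ m n : ℤ, ((n : ℂ) + b * m) * C (m + n) = n * C n + b * m * C m)
    (hb : b ≠ 1) (hb' : b ≠ -1) (n : ℤ) : C n = 0 := by
  have h1 := eq_mul_neg_of_weighted_additive h0 h n
  have h2 := eq_mul_neg_of_weighted_additive h0 h (-n)
  rw [neg_neg] at h2
  have h3 : ((b - 1) * (b + 1)) * C n = 0 := by linear_combination -h1 - b * h2
  refine (mul_eq_zero.mp h3).resolve_left (mul_ne_zero (sub_ne_zero.mpr hb) ?_)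
  exact fun h => hb' (eq_neg_of_add_eq_zero_left h)

/-- If `n ↦ n * C n` is additive, then `C` is constant away from `0`. -/
theorem eq_one_of_mul_additive {C : ℤ → ℂ}
    (h : ∀ m n : ℤ, ((n : ℂ) + m) * C (m + n) = n * C n + m * C m) {n : ℤ} (hn : n ≠ 0) :
    C n = C 1 := by
  let D : ℤ →+ ℂ := AddMonoidHom.mk' (fun n => n * C n) fun m n => by
    have := h m n
    push_cast
    linear_combination this
  have hD : (n : ℂ) * C n = n * C 1 := by simpa [D] using map_zsmul D n 1
  exact mul_left_cancel₀ (Int.cast_ne_zero.mpr hn) hD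

/-- A solution of the normalized relation with `b = -1` is linear. -/
theorem eq_mul_one_of_weighted_additive {C : ℤ → ℂ} (h0 : C 0 = 0)
    (h : ∀ m n : ℤ, ((n : ℂ) + -1 * m) * C (m + n) = n * C n + -1 * m * C m) (n : ℤ) :
    C n = n * C 1 := by
  have hneg := eq_mul_neg_of_weighted_additive h0 h
  have hnat (k : ℕ) : C k = k * C 1 := by
    induction k with
    | zero => simp [h0]
    | succ k ih =>
      have h1 := h (-1) (k + 1 : ℕ)
      rw [show (-1 : ℤ) + (k + 1 : ℕ) = k by push_cast; ring, ih] at h1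
      have h2 := hneg 1
      push_cast at h1 ⊢
      refine mul_left_cancel₀ (Nat.cast_add_one_ne_zero (R := ℂ) k) ?_
      linear_combination -h1 - h2
  obtain ⟨k, rfl | rfl⟩ := n.eq_nat_or_neg
  · simpa using hnat k
  · rw [hneg, neg_neg, hnat]
    push_cast
    ring


/-- let `b ∈ ℂ`, `λ ∈ ℂ \ {0}`, and `B : ℤ → ℂ` with `B 0 = 0` and
`(n + bm) B_{m+n} = n λ^m B_n + b m λ^n B_m` for all `m, n ∈ ℤ`. Then:
(i) if `b ∉ {1,−1}` then `B_m = 0` for all `m`; (ii) if `b = 1` then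
`B_m = B_1 λ^{m−1}` for all `m ≠ 0`; (iii) if `b = −1` then `B_m = m B_1 λ^{m−1}`
for all `m`. -/
theorem stmt19 (b lam : ℂ) (hlam : lam ≠ 0) (B : ℤ → ℂ) (h0 : B 0 = 0)
    (hrel : ∀ m n : ℤ, ((n : ℂ) + b * (m : ℂ)) * B (m + n)
        = (n : ℂ) * lam ^ m * B n + b * (m : ℂ) * lam ^ n * B m) :
    (b ≠ 1 → b ≠ -1 → ∀ m : ℤ, B m = 0) ∧
    (b = 1 → ∀ m : ℤ, m ≠ 0 → B m = B 1 * lam ^ (m - 1)) ∧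
    (b = -1 → ∀ m : ℤ, B m = (m : ℂ) * B 1 * lam ^ (m - 1)) := by
  obtain ⟨C, hC⟩ : ∃ C : ℤ → ℂ, ∀ m, B m = C m * lam ^ m :=
    ⟨fun m => B m * (lam ^ m)⁻¹, fun m => by
      rw [inv_mul_cancel_right₀ (zpow_ne_zero m hlam)]⟩
  have hC0 : C 0 = 0 := by simpa [h0] using (hC 0).symm
  have h (m n : ℤ) : ((n : ℂ) + b * m) * C (m + n) = n * C n + b * m * C m := by
    have := hrel m n
    rw [hC, hC, hC, zpow_add₀ hlam] at this
    refine mul_right_cancel₀ (mul_ne_zero (zpow_ne_zero m hlam) (zpow_ne_zero n hlam)) ?_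
    linear_combination this
  have hshift (m : ℤ) : B 1 * lam ^ (m - 1) = C 1 * lam ^ m := by
    rw [hC, zpow_sub_one₀ hlam, zpow_one]
    field_simp
  refine ⟨fun hb hb' m => ?_, ?_, ?_⟩
  · rw [hC, eq_zero_of_weighted_additive hC0 h hb hb', zero_mul]
  · rintro rfl m hm
    rw [hshift, hC, eq_one_of_mul_additive (C := C) (by simpa only [one_mul] using h) hm]
  · rintro rfl m
    rw [mul_assoc, hshift, hC, eq_mul_one_of_weighted_additive hC0 h m, mul_assoc]
end
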